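/- Let σ' be a nonempty finite CNN request sequence whose last request is r' = r(x',y'), let σ'' = σ', r(x'',y''), set Δx = |x'−x''|, Δy = |y'−y''|, assume Δx ≥ Δy, and let ∇ = sup_{s∈M} Sl_{W_{σ'}}(s; r(x'',y'')). Fix λ ∈ (0,1) and α with 0 < α ≤ (1−λ)/(12+4λ). Suppose F_{W_{σ''}} attains its infimum over M³ at (s_1,s_2,s_3). Then: (Case A) if the set {s_1,s_2,s_3} has cardinality 1 or 2, then inf F_{W_{σ''}} − inf F_{W_{σ'}} ≥ α·∇; and (Case B) if {s_1,s_2,s_3} has cardinality 3, then inf F_{W_{σ''}} − inf F_{W_{σ'}} ≥ α(1−λ)·Δy. -/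

import Mathlib

noncomputable section

/-- The L1 metric on `ℝ²` (the CNN metric space). -/
def dL1 (p q : ℝ × ℝ) : ℝ := |p.1 - q.1| + |p.2 - q.2|

/-- The CNN request associated with a point `(x, y)`. -/
def req (p : ℝ × ℝ) : Set (ℝ × ℝ) := {q | q.1 = p.1 ∨ q.2 = p.2}

/-- The work function of a finite CNN request sequence (requests listed in order of arrival),
starting at origin `O`. -/
noncomputable def WF (O : ℝ × ℝ) : List (ℝ × ℝ) → (ℝ × ℝ) → ℝ
  | [], s => dL1 O s
  | p :: l, s => sInf ((fun t => dL1 O t + WF t l s) '' req p)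

/-- The slack of a point `s` to a nonempty set `C` with respect to `W`. -/
noncomputable def Sl (lam : ℝ) (W : ℝ × ℝ → ℝ) (s : ℝ × ℝ) (C : Set (ℝ × ℝ)) : ℝ :=
  sInf ((fun t => W t + lam * dL1 t s) '' C) - W s

/-- The rectangle spanned by two points of `ℝ²`. -/
def Boks (s1 s2 : ℝ × ℝ) : Set (ℝ × ℝ) :=
  {p | p.1 ∈ Set.uIcc s1.1 s2.1 ∧ p.2 ∈ Set.uIcc s1.2 s2.2}

/-- `H_W(s₁,s₂) = (1/2)W(s₁) + (1/2)W(s₂) − (λ/2)d(s₁,s₂)`. -/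
noncomputable def Hf (lam : ℝ) (W : ℝ × ℝ → ℝ) (s1 s2 : ℝ × ℝ) : ℝ :=
  (1 / 2) * W s1 + (1 / 2) * W s2 - (lam / 2) * dL1 s1 s2

/-- `F_W(s₁,s₂,s₃) = H_W(s₁,s₂) − α·Sl_W(s₃;{s₁,s₂})`. -/
noncomputable def Ff (lam α : ℝ) (W : ℝ × ℝ → ℝ) (s1 s2 s3 : ℝ × ℝ) : ℝ :=
  Hf lam W s1 s2 - α * Sl lam W s3 {s1, s2}

/-- `inf_{M³} F_W`. -/
noncomputable def infF (lam α : ℝ) (W : ℝ × ℝ → ℝ) : ℝ :=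
  sInf (Set.range fun q : (ℝ × ℝ) × (ℝ × ℝ) × (ℝ × ℝ) => Ff lam α W q.1 q.2.1 q.2.2)

lemma dL1_nonneg (p q : ℝ × ℝ) : 0 ≤ dL1 p q := by
  unfold dL1; positivity

lemma dL1_self (p : ℝ × ℝ) : dL1 p p = 0 := by simp [dL1]

lemma dL1_comm (p q : ℝ × ℝ) : dL1 p q = dL1 q p := by
  unfold dL1; rw [abs_sub_comm p.1, abs_sub_comm p.2]

lemma dL1_tri (p q r : ℝ × ℝ) : dL1 p r ≤ dL1 p q + dL1 q r := by
  unfold dL1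
  have := abs_sub_le p.1 q.1 r.1
  have := abs_sub_le p.2 q.2 r.2
  linarith

lemma req_nonempty (p : ℝ × ℝ) : (req p).Nonempty := ⟨p, Or.inl rfl⟩

lemma WF_ge (l : List (ℝ × ℝ)) : ∀ O s, dL1 O s ≤ WF O l s := by
  induction l with
  | nil => intro O s; exact le_rfl
  | cons p l ih =>
    intro O s
    refine le_csInf ((req_nonempty p).image _) ?_
    rintro _ ⟨t, _, rfl⟩
    have := ih t s
    have := dL1_tri O t s
    simp only
    linarith

lemma WF_bdd (O p s : ℝ × ℝ) (l : List (ℝ × ℝ)) :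
    BddBelow ((fun t => dL1 O t + WF t l s) '' req p) := by
  refine ⟨0, ?_⟩
  rintro _ ⟨t, _, rfl⟩
  have := WF_ge l t s
  have := dL1_nonneg t s
  have := dL1_nonneg O t
  simp only
  linarith

lemma WF_lip (l : List (ℝ × ℝ)) : ∀ O s t, WF O l s ≤ WF O l t + dL1 t s := by
  induction l with
  | nil => intro O s t; exact dL1_tri O t s
  | cons p l ih =>
    intro O s t
    have : WF O (p :: l) s - dL1 t s ≤ WF O (p :: l) t := by
      refine le_csInf ((req_nonempty p).image _) ?_
      rintro _ ⟨u, hu, rfl⟩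
      have h1 : WF O (p :: l) s ≤ dL1 O u + WF u l s := csInf_le (WF_bdd O p s l) ⟨u, hu, rfl⟩
      have := ih u s t
      simp only
      linarith
    linarith

lemma WF_append (p : ℝ × ℝ) (l : List (ℝ × ℝ)) : ∀ O s, WF O (l ++ [p]) s =
    min (WF O l (p.1, s.2) + |p.1 - s.1|) (WF O l (s.1, p.2) + |p.2 - s.2|) := by
  induction l with
  | nil =>
    intro O s
    apply le_antisymm
    · apply le_min
      · refine csInf_le (WF_bdd O p s []) ⟨(p.1, s.2), Or.inl rfl, ?_⟩
        simp [WF, dL1]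
      · refine csInf_le (WF_bdd O p s []) ⟨(s.1, p.2), Or.inr rfl, ?_⟩
        simp [WF, dL1]
    · refine le_csInf ((req_nonempty p).image _) ?_
      rintro _ ⟨t, ht, rfl⟩
      simp only [WF, dL1]
      rcases ht with ht | ht
      · refine (min_le_left _ _).trans ?_
        rw [ht]
        have := abs_sub_le O.2 t.2 s.2
        linarith
      · refine (min_le_right _ _).trans ?_
        rw [ht]
        have := abs_sub_le O.1 t.1 s.1
        linarith
  | cons q l ih =>
    intro O s
    apply le_antisymm
    · apply le_min
      · rw [← sub_le_iff_le_add]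
        refine le_csInf ((req_nonempty q).image _) ?_
        rintro _ ⟨t, ht, rfl⟩
        have h1 : WF O (q :: (l ++ [p])) s ≤ dL1 O t + WF t (l ++ [p]) s :=
          csInf_le (WF_bdd O q s _) ⟨t, ht, rfl⟩
        have h2 := min_le_left (WF t l (p.1, s.2) + |p.1 - s.1|) (WF t l (s.1, p.2) + |p.2 - s.2|)
        rw [← ih] at h2
        simp only [List.cons_append]
        linarith
      · rw [← sub_le_iff_le_add]
        refine le_csInf ((req_nonempty q).image _) ?_
        rintro _ ⟨t, ht, rfl⟩
        have h1 : WF O (q :: (l ++ [p])) s ≤ dL1 O t + WF t (l ++ [p]) s :=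
          csInf_le (WF_bdd O q s _) ⟨t, ht, rfl⟩
        have h2 := min_le_right (WF t l (p.1, s.2) + |p.1 - s.1|) (WF t l (s.1, p.2) + |p.2 - s.2|)
        rw [← ih] at h2
        simp only [List.cons_append]
        linarith
    · refine le_csInf ((req_nonempty q).image _) ?_
      rintro _ ⟨t, ht, rfl⟩
      have h1 : ∀ z, WF O (q :: l) z ≤ dL1 O t + WF t l z := fun z =>
        csInf_le (WF_bdd O q z _) ⟨t, ht, rfl⟩
      change _ ≤ dL1 O t + WF t (l ++ [p]) s
      rw [ih]
      rcases min_choice (WF t l (p.1, s.2) + |p.1 - s.1|) (WF t l (s.1, p.2) + |p.2 - s.2|)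
        with h | h
      · rw [h]
        refine (min_le_left _ _).trans ?_
        have := h1 (p.1, s.2)
        linarith
      · rw [h]
        refine (min_le_right _ _).trans ?_
        have := h1 (s.1, p.2)
        linarith

lemma Sl_pair (lam : ℝ) (W : ℝ × ℝ → ℝ) (a b s : ℝ × ℝ) :
    Sl lam W s {a, b} = min (W a + lam * dL1 a s) (W b + lam * dL1 b s) - W s := by
  unfold Sl
  rw [Set.image_pair, csInf_pair]

lemma Ff_eq (lam α : ℝ) (W : ℝ × ℝ → ℝ) (a b s : ℝ × ℝ) :
    Ff lam α W a b s = (1 / 2) * W a + (1 / 2) * W b - (lam / 2) * dL1 a b -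
      α * (min (W a + lam * dL1 a s) (W b + lam * dL1 b s) - W s) := by
  unfold Ff Hf
  rw [Sl_pair]

lemma Ff_comm (lam α : ℝ) (W : ℝ × ℝ → ℝ) (a b s : ℝ × ℝ) :
    Ff lam α W a b s = Ff lam α W b a s := by
  rw [Ff_eq, Ff_eq, dL1_comm a b, min_comm]
  ring

lemma alpha_bound {lam α : ℝ} (h0 : 0 < lam) (hα1 : α ≤ (1 - lam) / (12 + 4 * lam)) :
    α * (12 + 4 * lam) ≤ 1 - lam := by
  rwa [le_div_iff₀ (by linarith)] at hα1

/-- Moving the first point. -/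
lemma move1 {lam α : ℝ} (h0 : 0 < lam) (hα0 : 0 < α)
    (hα1 : α * (12 + 4 * lam) ≤ 1 - lam) (W : ℝ × ℝ → ℝ) (a b s t : ℝ × ℝ)
    (h : W a = W t + dL1 t a) :
    Ff lam α W t b s + α * (1 - lam) * dL1 t a ≤ Ff lam α W a b s := by
  rw [Ff_eq, Ff_eq]
  have e1 : dL1 a b ≤ dL1 t a + dL1 t b := by
    rw [dL1_comm t a]; exact dL1_tri a t b
  have e2 := dL1_tri a t s
  rw [dL1_comm a t] at e2
  have hd := dL1_nonneg t a
  have hm : min (W a + lam * dL1 a s) (W b + lam * dL1 b s) ≤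
      min (W t + lam * dL1 t s) (W b + lam * dL1 b s) + (1 + lam) * dL1 t a := by
    rw [← min_add_add_right]
    apply min_le_min
    · rw [h]; nlinarith
    · nlinarith
  have hm' := mul_le_mul_of_nonneg_left hm hα0.le
  have e3 := mul_le_mul_of_nonneg_left e1 h0.le
  have e4 : 0 ≤ ((1 - lam) / 2 - α * (1 + lam) - α * (1 - lam)) * dL1 t a := by
    apply mul_nonneg _ hd
    nlinarith
  rw [h]
  rw [h] at hm'
  nlinarith

lemma move2 {lam α : ℝ} (h0 : 0 < lam) (hα0 : 0 < α)
    (hα1 : α * (12 + 4 * lam) ≤ 1 - lam) (W : ℝ × ℝ → ℝ) (a b s t : ℝ × ℝ)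
    (h : W b = W t + dL1 t b) :
    Ff lam α W a t s + α * (1 - lam) * dL1 t b ≤ Ff lam α W a b s := by
  rw [Ff_comm _ _ _ a t, Ff_comm _ _ _ a b]
  exact move1 h0 hα0 hα1 W b a s t h

lemma move3 {lam α : ℝ} (h0 : 0 < lam) (hα0 : 0 < α) (W : ℝ × ℝ → ℝ) (a b s t : ℝ × ℝ)
    (h : W s = W t + dL1 t s) :
    Ff lam α W a b t + α * (1 - lam) * dL1 t s ≤ Ff lam α W a b s := by
  rw [Ff_eq, Ff_eq]
  have hm : min (W a + lam * dL1 a s) (W b + lam * dL1 b s) ≤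
      min (W a + lam * dL1 a t) (W b + lam * dL1 b t) + lam * dL1 t s := by
    rw [← min_add_add_right]
    have := dL1_tri a t s
    have := dL1_tri b t s
    apply min_le_min <;> nlinarith
  have hm' := mul_le_mul_of_nonneg_left hm hα0.le
  rw [h]
  nlinarith

lemma dL1_eq_zero {p q : ℝ × ℝ} (h : dL1 p q ≤ 0) : p = q := by
  unfold dL1 at h
  have a := abs_nonneg (p.1 - q.1)
  have b := abs_nonneg (p.2 - q.2)
  have ha : |p.1 - q.1| = 0 := by linarith
  have hb : |p.2 - q.2| = 0 := by linarith
  rw [abs_eq_zero, sub_eq_zero] at ha hb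
  exact Prod.ext ha hb

lemma Ff_nonneg {lam α : ℝ} (h0 : 0 < lam) (hα0 : 0 < α)
    (hα1 : α * (12 + 4 * lam) ≤ 1 - lam) (W : ℝ × ℝ → ℝ) (O : ℝ × ℝ)
    (hW : ∀ s, dL1 O s ≤ W s) (a b s : ℝ × ℝ) : 0 ≤ Ff lam α W a b s := by
  rw [Ff_eq]
  have hl : lam < 1 := by nlinarith
  have ha := hW a
  have hb := hW b
  have hs := hW s
  have na := dL1_nonneg O a
  have nb := dL1_nonneg O b
  have ns := dL1_nonneg O s
  have t1 := dL1_tri a O b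
  have t2 := dL1_tri a O s
  rw [dL1_comm a O] at t1 t2
  have hm := min_le_left (W a + lam * dL1 a s) (W b + lam * dL1 b s)
  have hm1 : min (W a + lam * dL1 a s) (W b + lam * dL1 b s) - W s ≤ W a + lam * dL1 O a := by
    nlinarith
  have hm' := mul_le_mul_of_nonneg_left hm1 hα0.le
  have k1 : 0 ≤ (1 / 2 - α) * (W a - dL1 O a) := mul_nonneg (by nlinarith) (by linarith)
  have k2 : 0 ≤ (1 / 2 - α - lam / 2 - α * lam) * dL1 O a := mul_nonneg (by nlinarith) na
  nlinarith

lemma infF_le {lam α : ℝ} (h0 : 0 < lam) (hα0 : 0 < α)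
    (hα1 : α * (12 + 4 * lam) ≤ 1 - lam) (W : ℝ × ℝ → ℝ) (O : ℝ × ℝ)
    (hW : ∀ s, dL1 O s ≤ W s) (a b s : ℝ × ℝ) : infF lam α W ≤ Ff lam α W a b s := by
  refine csInf_le ⟨0, ?_⟩ ⟨(a, b, s), rfl⟩
  rintro _ ⟨q, rfl⟩
  exact Ff_nonneg h0 hα0 hα1 W O hW _ _ _

/-- A minimizing coordinate that can be moved stays put. -/
lemma stay {lam α d A B : ℝ} (h1 : lam < 1) (hα0 : 0 < α)
    (h : A + α * (1 - lam) * d ≤ B) (h' : B ≤ A) : d ≤ 0 := by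
  have : 0 < α * (1 - lam) := mul_pos hα0 (by linarith)
  by_contra hd
  push Not at hd
  have := mul_pos this hd
  linarith

lemma pair_card_le (a b : ℝ × ℝ) : ({a, b} : Set (ℝ × ℝ)).ncard ≤ 2 := by
  have := Set.ncard_insert_le a ({b} : Set (ℝ × ℝ))
  rwa [Set.ncard_singleton] at this

lemma main_abs {lam α : ℝ} (h0 : 0 < lam) (h1 : lam < 1) (hα0 : 0 < α)
    (hα1 : α * (12 + 4 * lam) ≤ 1 - lam) (W V : ℝ × ℝ → ℝ) (O : ℝ × ℝ)
    (x' y' x'' y'' : ℝ) (hxy : |x' - x''| ≥ |y' - y''|)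
    (hW : ∀ s, dL1 O s ≤ W s) (hL : ∀ s t, W s ≤ W t + dL1 t s)
    (hW' : ∀ s : ℝ × ℝ, W s = W (x', s.2) + dL1 (x', s.2) s ∨
      W s = W (s.1, y') + dL1 (s.1, y') s)
    (hVW : ∀ s ∈ req (x'', y''), V s = W s)
    (hV : ∀ s, ∃ t ∈ req (x'', y''), V s = V t + dL1 t s)
    (s1 s2 s3 : ℝ × ℝ)
    (hmin : ∀ t1 t2 t3, Ff lam α V s1 s2 s3 ≤ Ff lam α V t1 t2 t3) :
    ((s1 = s2 ∨ s1 = s3 ∨ s2 = s3) → ∀ s,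
      infF lam α W + α * Sl lam W s (req (x'', y'')) ≤ Ff lam α V s1 s2 s3) ∧
    (¬ (s1 = s2 ∨ s1 = s3 ∨ s2 = s3) →
      infF lam α W + α * (1 - lam) * |y' - y''| ≤ Ff lam α V s1 s2 s3) := by
  constructor
  · intro hc s
    have key : ∃ a b, Hf lam V a b ≤ Ff lam α V s1 s2 s3 := by
      rcases hc with rfl | rfl | rfl
      · refine ⟨s1, s3, ?_⟩
        have h := hmin s1 s1 s1
        rw [Ff_eq, Ff_eq] at h
        rw [Ff_eq]
        unfold Hf
        simp only [dL1_self, min_self] at h ⊢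
        have hX : 0 ≤ V s1 + lam * dL1 s1 s3 - V s3 := by
          by_contra hX
          push Not at hX
          nlinarith
        have : 0 ≤ (1 / 2 - α) * (V s1 + lam * dL1 s1 s3 - V s3) :=
          mul_nonneg (by nlinarith) hX
        nlinarith
      · refine ⟨s1, s2, ?_⟩
        rw [Ff_eq]
        unfold Hf
        have := min_le_left (V s1 + lam * dL1 s1 s1) (V s2 + lam * dL1 s2 s1)
        rw [dL1_self] at this
        rw [dL1_self]
        nlinarith
      · refine ⟨s1, s2, ?_⟩
        rw [Ff_eq]
        unfold Hf
        have := min_le_right (V s1 + lam * dL1 s1 s2) (V s2 + lam * dL1 s2 s2)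
        rw [dL1_self] at this
        rw [dL1_self]
        nlinarith
    obtain ⟨a, b, hab⟩ := key
    obtain ⟨t, ht, hat⟩ := hV a
    obtain ⟨u, hu, hbu⟩ := hV b
    have hH : Hf lam W t u ≤ Hf lam V a b := by
      unfold Hf
      rw [hat, hbu, hVW t ht, hVW u hu]
      have e1 := dL1_tri a t b
      have e2 := dL1_tri t u b
      rw [dL1_comm a t] at e1
      have := dL1_nonneg t a
      have := dL1_nonneg u b
      nlinarith
    have hS : Sl lam W s (req (x'', y'')) ≤ Sl lam W s {t, u} := by
      unfold Sl
      apply sub_le_sub_right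
      apply csInf_le_csInf
      · refine ⟨0, ?_⟩
        rintro _ ⟨v, _, rfl⟩
        have := hW v
        have := dL1_nonneg O v
        have := dL1_nonneg v s
        simp only
        nlinarith
      · exact (Set.insert_nonempty _ _).image _
      · apply Set.image_mono
        rintro v (rfl | rfl)
        · exact ht
        · exact hu
    have hI := infF_le h0 hα0 hα1 W O hW t u s
    have hS' := mul_le_mul_of_nonneg_left hS hα0.le
    unfold Ff at hI
    linarith
  · intro hc
    -- minimality forces immovable points
    have st1 : ∀ t, V s1 = V t + dL1 t s1 → t = s1 := fun t ht =>
      dL1_eq_zero (stay h1 hα0 (move1 h0 hα0 hα1 V s1 s2 s3 t ht) (hmin _ _ _))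
    have st2 : ∀ t, V s2 = V t + dL1 t s2 → t = s2 := fun t ht =>
      dL1_eq_zero (stay h1 hα0 (move2 h0 hα0 hα1 V s1 s2 s3 t ht) (hmin _ _ _))
    have st3 : ∀ t, V s3 = V t + dL1 t s3 → t = s3 := fun t ht =>
      dL1_eq_zero (stay h1 hα0 (move3 h0 hα0 V s1 s2 s3 t ht) (hmin _ _ _))
    have inr : ∀ s, (∀ t, V s = V t + dL1 t s → t = s) → s ∈ req (x'', y'') := by
      intro s hs
      obtain ⟨t, ht, h⟩ := hV s
      rwa [← hs t h]
    have r1 := inr s1 st1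
    have r2 := inr s2 st2
    have r3 := inr s3 st3
    have hF : Ff lam α V s1 s2 s3 = Ff lam α W s1 s2 s3 := by
      rw [Ff_eq, Ff_eq, hVW _ r1, hVW _ r2, hVW _ r3]
    have dich : ∀ s, (∀ t, V s = V t + dL1 t s → t = s) →
        (s = (x'', y') ∨ s = (x', y'')) ∨
        ∃ t, W s = W t + dL1 t s ∧ |y' - y''| ≤ dL1 t s := by
      intro s hs
      have hr := inr s hs
      have hr0 := hr
      rcases hr with hr | hr <;> simp only at hr
      · rcases hW' s with h | h
        · right
          refine ⟨_, h, ?_⟩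
          simp only [dL1, hr, sub_self, abs_zero, add_zero]
          exact hxy
        · left; left
          rw [← hVW s hr0, ← hVW (s.1, y') (Or.inl hr)] at h
          rw [← hs _ h, hr]
      · rcases hW' s with h | h
        · left; right
          rw [← hVW s hr0, ← hVW (x', s.2) (Or.inr hr)] at h
          rw [← hs _ h, hr]
        · right
          refine ⟨_, h, ?_⟩
          simp only [dL1, hr, sub_self, abs_zero, zero_add]
          exact le_rfl
    have hpos : 0 ≤ α * (1 - lam) := mul_nonneg hα0.le (by linarith)
    rw [hF]
    rcases dich s1 st1 with d1 | ⟨t, ht, hd⟩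
    · rcases dich s2 st2 with d2 | ⟨t, ht, hd⟩
      · rcases dich s3 st3 with d3 | ⟨t, ht, hd⟩
        · exfalso
          apply hc
          rcases d1 with rfl | rfl <;> rcases d2 with rfl | rfl <;>
            rcases d3 with rfl | rfl <;> simp
        · have a1 := move3 h0 hα0 W s1 s2 s3 t ht
          have a2 := infF_le h0 hα0 hα1 W O hW s1 s2 t
          have a3 := mul_le_mul_of_nonneg_left hd hpos
          linarith
      · have a1 := move2 h0 hα0 hα1 W s1 s2 s3 t ht
        have a2 := infF_le h0 hα0 hα1 W O hW s1 t s3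
        have a3 := mul_le_mul_of_nonneg_left hd hpos
        linarith
    · have a1 := move1 h0 hα0 hα1 W s1 s2 s3 t ht
      have a2 := infF_le h0 hα0 hα1 W O hW t s2 s3
      have a3 := mul_le_mul_of_nonneg_left hd hpos
      linarith

/-- Increase of `inf F` when the request `r(x'',y'')` arrives after a sequence ending in
`r(x',y')` (with `Δx ≥ Δy`): if `F_{W_{σ''}}` is minimized at `(s₁,s₂,s₃)`, then (Case A) if
`{s₁,s₂,s₃}` has cardinality at most 2, the increase is at least `α·∇`; (Case B) if it has
cardinality 3, the increase is at least `α(1−λ)·Δy`. -/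
theorem infF_increase (lam α : ℝ) (h0 : 0 < lam) (h1 : lam < 1)
    (hα0 : 0 < α) (hα1 : α ≤ (1 - lam) / (12 + 4 * lam))
    (O : ℝ × ℝ) (l : List (ℝ × ℝ)) (x' y' x'' y'' : ℝ)
    (hxy : |x' - x''| ≥ |y' - y''|) (s1 s2 s3 : ℝ × ℝ)
    (hmin : ∀ t1 t2 t3 : ℝ × ℝ,
      Ff lam α (WF O (l ++ [(x', y'), (x'', y'')])) s1 s2 s3 ≤
        Ff lam α (WF O (l ++ [(x', y'), (x'', y'')])) t1 t2 t3) :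
    (({s1, s2, s3} : Set (ℝ × ℝ)).ncard ≤ 2 →
      infF lam α (WF O (l ++ [(x', y'), (x'', y'')])) -
          infF lam α (WF O (l ++ [(x', y')])) ≥
        α * sSup (Set.range fun s =>
          Sl lam (WF O (l ++ [(x', y')])) s (req (x'', y'')))) ∧
    (({s1, s2, s3} : Set (ℝ × ℝ)).ncard = 3 →
      infF lam α (WF O (l ++ [(x', y'), (x'', y'')])) -
          infF lam α (WF O (l ++ [(x', y')])) ≥
        α * (1 - lam) * |y' - y''|) := by
  have hα := alpha_bound h0 hα1
  have happ : l ++ [(x', y'), (x'', y'')] = (l ++ [(x', y')]) ++ [(x'', y'')] := by simp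
  rw [happ] at hmin ⊢
  set W := WF O (l ++ [(x', y')]) with hWd
  set V := WF O ((l ++ [(x', y')]) ++ [(x'', y'')]) with hVd
  have hL : ∀ s t, W s ≤ W t + dL1 t s := WF_lip _ O
  have hW' : ∀ s : ℝ × ℝ, W s = W (x', s.2) + dL1 (x', s.2) s ∨
      W s = W (s.1, y') + dL1 (s.1, y') s := by
    intro s
    have e : ∀ s, W s = _ := WF_append (x', y') l O
    have l1 := hL s (x', s.2)
    have l2 := hL s (s.1, y')
    have m1 := (e (x', s.2)).le.trans (min_le_left _ _)
    have m2 := (e (s.1, y')).le.trans (min_le_right _ _)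
    have es := e s
    simp only [dL1, sub_self, abs_zero, add_zero, zero_add] at *
    rcases min_choice (WF O l (x', s.2) + |x' - s.1|) (WF O l (s.1, y') + |y' - s.2|) with h | h
    · left; rw [h] at es; linarith
    · right; rw [h] at es; linarith
  have eV : ∀ s : ℝ × ℝ, V s =
      min (W (x'', s.2) + |x'' - s.1|) (W (s.1, y'') + |y'' - s.2|) :=
    WF_append (x'', y'') _ O
  have hVW : ∀ s ∈ req (x'', y''), V s = W s := by
    intro s hs
    have l1 := hL s (x'', s.2)
    have l2 := hL s (s.1, y'')
    simp only [dL1, sub_self, abs_zero, add_zero, zero_add] at l1 l2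
    rw [eV]
    apply le_antisymm
    · rcases hs with hs | hs <;> simp only at hs
      · refine (min_le_left _ _).trans ?_
        simp [← hs]
      · refine (min_le_right _ _).trans ?_
        simp [← hs]
    · exact le_min l1 l2
  have hV : ∀ s, ∃ t ∈ req (x'', y''), V s = V t + dL1 t s := by
    intro s
    have es := eV s
    rcases min_choice (W (x'', s.2) + |x'' - s.1|) (W (s.1, y'') + |y'' - s.2|) with h | h
    · have hr : (x'', s.2) ∈ req (x'', y'') := Or.inl rfl
      refine ⟨_, hr, ?_⟩
      rw [hVW _ hr, es, h]; simp [dL1]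
    · have hr : (s.1, y'') ∈ req (x'', y'') := Or.inr rfl
      refine ⟨_, hr, ?_⟩
      rw [hVW _ hr, es, h]; simp [dL1]
  obtain ⟨hA, hB⟩ := main_abs h0 h1 hα0 hα W V O x' y' x'' y'' hxy (WF_ge _ O) hL hW' hVW hV
    s1 s2 s3 hmin
  have hI : Ff lam α V s1 s2 s3 ≤ infF lam α V := by
    refine le_csInf (Set.range_nonempty _) ?_
    rintro _ ⟨q, rfl⟩
    exact hmin _ _ _
  constructor
  · intro hc
    have hc' : s1 = s2 ∨ s1 = s3 ∨ s2 = s3 := by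
      by_contra hn
      push Not at hn
      have : ({s1, s2, s3} : Set (ℝ × ℝ)).ncard = 3 :=
        Set.ncard_eq_three.mpr ⟨s1, s2, s3, hn.1, hn.2.1, hn.2.2, rfl⟩
      omega
    have hS : sSup (Set.range fun s => Sl lam W s (req (x'', y''))) ≤
        (infF lam α V - infF lam α W) / α := by
      refine csSup_le (Set.range_nonempty _) ?_
      rintro _ ⟨s, rfl⟩
      rw [le_div_iff₀ hα0]
      have := hA hc' s
      simp only
      linarith
    rw [le_div_iff₀ hα0] at hS
    linarith
  · intro hc
    have hc' : ¬ (s1 = s2 ∨ s1 = s3 ∨ s2 = s3) := by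
      intro hn
      have h2 : ({s1, s2, s3} : Set (ℝ × ℝ)).ncard ≤ 2 := by
        rcases hn with rfl | rfl | rfl
        · simpa using pair_card_le s1 s3
        · rw [Set.pair_comm s2 s1]; simpa using pair_card_le s1 s2
        · simpa using pair_card_le s1 s2
      omega
    have := hB hc'
    linarith
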